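/- Transfer inequality. Let S be a finite set of parameters, {Q_t : t ∈ S} probability measures on (Y, A), {P_t : t ∈ S} probability measures on (Ω, F), and K a probability kernel from (Y, A) to (Ω, F) with max_{t ∈ S} ‖Q_t K − P_t‖₁ ≤ ε. Let T be a measurable action space and L : S × T → [0, ∞] with z ↦ L_t(z) measurable, and let M > 0. Then for every probability kernel τ from (Ω, F) to T, max_{t ∈ S} ∫∫ (M ∧ L_t(z)) τ_ω(dz) P_t(dω) ≥ inf_ρ max_{t ∈ S} ∫∫ (M ∧ L_t(z)) ρ_y(dz) Q_t(dy) − M ε, where the infimum runs over all probability kernels ρ from (Y, A) to T. -/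

import Mathlib

open MeasureTheory ProbabilityTheory Filter Topology
open scoped ENNReal NNReal

/-- Total variation distance between two measures:
`‖μ − ν‖₁ = sup { |∫ f dμ − ∫ f dν| : f measurable, |f| ≤ 1 }`. -/
noncomputable def tvDist {α : Type*} [MeasurableSpace α] (μ ν : Measure α) : ℝ :=
  ⨆ f : { f : α → ℝ // Measurable f ∧ ∀ x, |f x| ≤ 1 },
    |∫ x, f.1 x ∂μ - ∫ x, f.1 x ∂ν|

theorem abs_integral_sub_integral_le_tvDist {α : Type*} [MeasurableSpace α]
    (μ ν : Measure α) [IsProbabilityMeasure μ] [IsProbabilityMeasure ν]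
    {f : α → ℝ} (hf : Measurable f) (hf1 : ∀ x, |f x| ≤ 1) :
    |∫ x, f x ∂μ - ∫ x, f x ∂ν| ≤ tvDist μ ν := by
  have integral_bound (ρ : Measure α) [IsProbabilityMeasure ρ] {g : α → ℝ}
      (hg : ∀ x, |g x| ≤ 1) : |∫ x, g x ∂ρ| ≤ 1 := by
    simpa using norm_integral_le_of_norm_le_const (μ := ρ) (f := g) (C := 1) (ae_of_all _ hg)
  refine le_ciSup (f := fun f : { f : α → ℝ // Measurable f ∧ ∀ x, |f x| ≤ 1 } ↦
    |∫ x, f.1 x ∂μ - ∫ x, f.1 x ∂ν|) ⟨2, ?_⟩ ⟨f, hf, hf1⟩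
  rintro _ ⟨g, rfl⟩
  have hμ := integral_bound μ g.2.2
  have hν := integral_bound ν g.2.2
  exact (abs_sub _ _).trans (by linarith)

theorem lintegral_le_lintegral_add_mul_tvDist {α : Type*} [MeasurableSpace α]
    (μ ν : Measure α) [IsProbabilityMeasure μ] [IsProbabilityMeasure ν]
    {g : α → ℝ≥0∞} (hg : Measurable g) {M : ℝ≥0∞} (hM0 : M ≠ 0) (hMtop : M ≠ ⊤)
    (hgM : ∀ x, g x ≤ M) :
    ∫⁻ x, g x ∂μ ≤ ∫⁻ x, g x ∂ν + M * ENNReal.ofReal (tvDist μ ν) := by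
  have hh : Measurable fun x ↦ g x / M := hg.div_const M
  have hh1 (x : α) : g x / M ≤ 1 := ENNReal.div_le_of_le_mul (by simpa using hgM x)
  have hhtop (x : α) : g x / M ≠ ⊤ := ne_top_of_le_ne_top ENNReal.one_ne_top (hh1 x)
  have lintegral_eq (ρ : Measure α) [IsProbabilityMeasure ρ] :
      ∫⁻ x, g x ∂ρ = M * ENNReal.ofReal (∫ x, (g x / M).toReal ∂ρ) := by
    have hfin : ∫⁻ x, g x / M ∂ρ ≠ ⊤ :=
      ne_top_of_le_ne_top ENNReal.one_ne_top
        ((lintegral_mono hh1).trans (by simp))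
    rw [integral_toReal hh.aemeasurable (ae_of_all _ fun x ↦ (hhtop x).lt_top),
      ENNReal.ofReal_toReal hfin, ← lintegral_const_mul M hh]
    simp_rw [ENNReal.mul_div_cancel hM0 hMtop]
  have key := abs_integral_sub_integral_le_tvDist μ ν hh.ennreal_toReal fun x ↦ by
    rw [abs_of_nonneg ENNReal.toReal_nonneg]
    exact ENNReal.toReal_le_of_le_ofReal zero_le_one (by simpa using hh1 x)
  rw [lintegral_eq μ, lintegral_eq ν, ← mul_add]
  gcongr
  refine (ENNReal.ofReal_le_ofReal ?_).trans ENNReal.ofReal_add_le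
  linarith [(abs_le.mp key).2]

/-- **Transfer inequality.**  If `max_{t ∈ S} ‖Q_t K − P_t‖₁ ≤ ε`, then for every
randomized estimator `τ` under the `P`-experiment,
`max_{t ∈ S} ∬ (M ∧ L_t) dτ dP_t ≥ inf_ρ max_{t ∈ S} ∬ (M ∧ L_t) dρ dQ_t − M ε`
(the finite parameter set `S` is modelled by a `Fintype` index `ι`). -/
theorem statement11 {ι T Ω 𝓨 : Type*} [Fintype ι]
    [MeasurableSpace T] [MeasurableSpace Ω] [MeasurableSpace 𝓨]
    (Q : ι → Measure 𝓨) [∀ i, IsProbabilityMeasure (Q i)]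
    (P : ι → Measure Ω) [∀ i, IsProbabilityMeasure (P i)]
    (K : Kernel 𝓨 Ω) [IsMarkovKernel K]
    (L : ι → T → ℝ≥0∞) (hL : ∀ i, Measurable (L i))
    {ε : ℝ} (hε : 0 ≤ ε)
    (hK : ∀ i, tvDist ((Q i).bind K) (P i) ≤ ε)
    (M : ℝ≥0∞) (hM0 : 0 < M) (hMtop : M ≠ ⊤)
    (τ : Kernel Ω T) [IsMarkovKernel τ] :
    (⨅ ρ : { ρ : Kernel 𝓨 T // IsMarkovKernel ρ },
        ⨆ i : ι, ∫⁻ y, ∫⁻ z, min M (L i z) ∂(ρ.1 y) ∂(Q i)) - M * ENNReal.ofReal ε ≤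
      ⨆ i : ι, ∫⁻ ω, ∫⁻ z, min M (L i z) ∂(τ ω) ∂(P i) := by
  rw [tsub_le_iff_right]
  refine (iInf_le _ ⟨τ ∘ₖ K, inferInstance⟩).trans (iSup_le fun i ↦ ?_)
  have hmin : Measurable fun z ↦ min M (L i z) := measurable_const.min (hL i)
  have hrisk : Measurable fun ω ↦ ∫⁻ z, min M (L i z) ∂(τ ω) := hmin.lintegral_kernel
  have hriskM (ω : Ω) : ∫⁻ z, min M (L i z) ∂(τ ω) ≤ M :=
    (lintegral_mono fun z ↦ min_le_left M (L i z)).trans (by simp)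
  calc
    ∫⁻ y, ∫⁻ z, min M (L i z) ∂((τ ∘ₖ K) y) ∂(Q i)
      = ∫⁻ ω, ∫⁻ z, min M (L i z) ∂(τ ω) ∂((Q i).bind K) := by
        simp_rw [Kernel.lintegral_comp τ K _ hmin]
        rw [Measure.lintegral_bind K.aemeasurable hrisk.aemeasurable]
    _ ≤ ∫⁻ ω, ∫⁻ z, min M (L i z) ∂(τ ω) ∂(P i)
          + M * ENNReal.ofReal (tvDist ((Q i).bind K) (P i)) :=
        lintegral_le_lintegral_add_mul_tvDist _ _ hrisk hM0.ne' hMtop hriskM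
    _ ≤ _ := by
        gcongr
        · exact le_iSup (fun i ↦ ∫⁻ ω, ∫⁻ z, min M (L i z) ∂(τ ω) ∂(P i)) i
        · exact hK i
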